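/- arXiv:0808.3518 — 3 statements merged into one kernel-verified Lean document; each statement's English description precedes it below -/
import Mathlib

section
/- The maps π : Pos(Λ) → V*/ℝ_{>0} and Pos̄ : V*/ℝ_{>0} → Pos(Λ) are continuous, and π ∘ Pos̄ = Id on V*/ℝ_{>0}. -/
open scoped TensorProduct

variable (Λ : Type) [AddCommGroup Λ]

/-- A subset `X` of a lattice `Λ` is a *positive part* if `Λ = X ∪ (-X)`,
`X + X ⊆ X`, and `X ∩ (-X)` is a subgroup of `Λ`. -/
def IsPositivePart (X : Set Λ) : Prop :=
  X ∪ (-X) = Set.univ ∧ (∀ a ∈ X, ∀ b ∈ X, a + b ∈ X) ∧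
    ∃ H : AddSubgroup Λ, (H : Set Λ) = X ∩ (-X)

/-- `Pos(Λ)`, the set of positive parts of `Λ`. -/
def PosParts : Type := {X : Set Λ // IsPositivePart Λ X}

/-- `U(E) = {X ∈ Pos(Λ) | X ∩ E = ∅}`. -/
def UU (E : Set Λ) : Set (PosParts Λ) := {X | X.val ∩ E = ∅}

/-- The topology on `Pos(Λ)`: a subset `U` is open iff for every `X ∈ U` there is a
finite set `E ⊆ Λ` with `X ∈ U(E)` and `U(E) ⊆ U`. -/
instance posTop : TopologicalSpace (PosParts Λ) where
  IsOpen U := ∀ X ∈ U, ∃ E : Finset Λ, X ∈ UU Λ (E : Set Λ) ∧ UU Λ (E : Set Λ) ⊆ U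
  isOpen_univ := by
    intro X _
    exact ⟨∅, by simp [UU], fun _ _ => trivial⟩
  isOpen_inter := by
    rintro s t hs ht X ⟨hXs, hXt⟩
    obtain ⟨E1, h1, h1'⟩ := hs X hXs
    obtain ⟨E2, h2, h2'⟩ := ht X hXt
    letI := Classical.decEq Λ
    refine ⟨E1 ∪ E2, ?_, ?_⟩
    · simp only [UU, Set.mem_setOf_eq, Finset.coe_union, Set.inter_union_distrib_left] at *
      rw [h1, h2, Set.union_empty]
    · intro Y hY
      simp only [UU, Set.mem_setOf_eq, Finset.coe_union, Set.inter_union_distrib_left,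
        Set.union_empty_iff] at hY
      exact ⟨h1' hY.1, h2' hY.2⟩
  isOpen_sUnion := by
    intro S hS X hX
    obtain ⟨s, hs, hXs⟩ := hX
    obtain ⟨E, hE, hE'⟩ := hS s hs X hXs
    exact ⟨E, hE, fun Y hY => ⟨s, hs, hE' hY⟩⟩

/-- The real vector space `V = ℝ ⊗_ℤ Λ` spanned by the lattice `Λ`. -/
abbrev RV : Type := ℝ ⊗[ℤ] Λ

/-- The canonical map `Λ → ℝ ⊗_ℤ Λ`, `λ ↦ 1 ⊗ λ`. -/
noncomputable def iota : Λ →ₗ[ℤ] RV Λ := TensorProduct.mk ℤ ℝ Λ 1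

/-- `Pos(φ) = {λ ∈ Λ | φ(λ) ≥ 0}` for a linear form `φ` on `V = ℝ ⊗_ℤ Λ`. -/
def PosSet (φ : Module.Dual ℝ (RV Λ)) : Set Λ := {l | 0 ≤ φ (iota Λ l)}

/-- The weak topology on the dual space `V*` (`V` being finite dimensional, this is
its standard topology). -/
noncomputable instance dualTop : TopologicalSpace (Module.Dual ℝ (RV Λ)) :=
  ⨅ v : RV Λ, TopologicalSpace.induced (fun φ => φ v) inferInstance

/-- Two linear forms on `V` are equivalent iff they differ by a strictly positive scalar. -/
def dualSetoid : Setoid (Module.Dual ℝ (RV Λ)) where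
  r φ ψ := ∃ κ : ℝ, 0 < κ ∧ ψ = κ • φ
  iseqv := by
    constructor
    · exact fun φ => ⟨1, one_pos, (one_smul ℝ φ).symm⟩
    · rintro φ ψ ⟨κ, hκ, rfl⟩
      exact ⟨κ⁻¹, inv_pos.2 hκ, by rw [smul_smul, inv_mul_cancel₀ hκ.ne', one_smul]⟩
    · rintro φ ψ χ ⟨κ, hκ, rfl⟩ ⟨κ', hκ', rfl⟩
      exact ⟨κ' * κ, mul_pos hκ' hκ, smul_smul κ' κ φ⟩

/-- `V*/ℝ_{>0}`, the quotient of the dual space by positive rescaling, endowed with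
the quotient topology. -/
abbrev DualQuot : Type := Quotient (dualSetoid Λ)

theorem isPositivePart_posSet (φ : Module.Dual ℝ (RV Λ)) :
    IsPositivePart Λ (PosSet Λ φ) := by
  refine ⟨?_, ?_, ?_⟩
  · ext l
    simp only [Set.mem_union, Set.mem_neg, PosSet, Set.mem_setOf_eq, Set.mem_univ, iff_true,
      map_neg]
    rcases le_total 0 (φ (iota Λ l)) with h | h
    · exact Or.inl h
    · exact Or.inr (by simpa using h)
  · intro a ha b hb
    simp only [PosSet, Set.mem_setOf_eq, map_add] at *
    exact add_nonneg ha hb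
  · refine ⟨AddMonoidHom.ker ((φ.toAddMonoidHom).comp (iota Λ).toAddMonoidHom), ?_⟩
    ext l
    simp only [SetLike.mem_coe, Set.mem_inter_iff, Set.mem_neg]
    constructor
    · intro h
      have h' : φ (iota Λ l) = 0 := h
      constructor
      · exact le_of_eq h'.symm
      · show (0:ℝ) ≤ φ (iota Λ (-l))
        rw [map_neg, map_neg, h', neg_zero]
    · rintro ⟨h1, h2⟩
      have h1' : (0:ℝ) ≤ φ (iota Λ l) := h1
      have h2' : (0:ℝ) ≤ φ (iota Λ (-l)) := h2
      rw [map_neg, map_neg] at h2'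
      show φ (iota Λ l) = 0
      linarith

/-- The map `Pos̄ : V*/ℝ_{>0} → Pos(Λ)` induced by `φ ↦ Pos(φ)`. -/
noncomputable def Posbar : DualQuot Λ → PosParts Λ :=
  Quotient.lift (fun φ => (⟨PosSet Λ φ, isPositivePart_posSet Λ φ⟩ : PosParts Λ))
    (by
      rintro φ ψ ⟨κ, hκ, rfl⟩
      apply Subtype.ext
      ext l
      show (0:ℝ) ≤ φ (iota Λ l) ↔ (0:ℝ) ≤ (κ • φ) (iota Λ l)
      rw [LinearMap.smul_apply, smul_eq_mul]
      exact (mul_nonneg_iff_of_pos_left hκ).symm)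

/-- Characterization of the map `π : Pos(Λ) → V*/ℝ_{>0}` from the Hahn–Banach theorem
for positive parts: `π X` is the unique class `φ̄` with `X ⊆ Pos(φ)` (represented by a
nonzero form when `X ≠ Λ`, and `π(Λ) = 0̄`). -/
def IsPi (π : PosParts Λ → DualQuot Λ) : Prop :=
  ∀ X : PosParts Λ, ∃ φ : Module.Dual ℝ (RV Λ),
    π X = Quotient.mk (dualSetoid Λ) φ ∧ X.val ⊆ PosSet Λ φ ∧ (X.val ≠ Set.univ → φ ≠ 0)

theorem aux_ext [Module.Free ℤ Λ] [Module.Finite ℤ Λ] (φ ψ : Module.Dual ℝ (RV Λ))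
    (h : ∀ l, φ (iota Λ l) = ψ (iota Λ l)) : φ = ψ := by
  apply (Algebra.TensorProduct.basis ℝ (Module.Free.chooseBasis ℤ Λ)).ext
  intro i
  rw [Algebra.TensorProduct.basis_apply]
  exact h (Module.Free.chooseBasis ℤ Λ i)

theorem aux_iota_sum [Module.Free ℤ Λ] [Module.Finite ℤ Λ] (φ : Module.Dual ℝ (RV Λ))
    (z : Module.Free.ChooseBasisIndex ℤ Λ → ℤ) :
    φ (iota Λ (∑ i, z i • Module.Free.chooseBasis ℤ Λ i)) =
      ∑ i, (z i : ℝ) * φ (iota Λ (Module.Free.chooseBasis ℤ Λ i)) := by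
  rw [map_sum, map_sum]
  refine Finset.sum_congr rfl fun i _ => ?_
  rw [map_zsmul, map_zsmul, zsmul_eq_mul]

theorem aux_vec_sum [Module.Free ℤ Λ] [Module.Finite ℤ Λ] (φ : Module.Dual ℝ (RV Λ))
    (v : RV Λ) :
    φ v = ∑ i, (Algebra.TensorProduct.basis ℝ (Module.Free.chooseBasis ℤ Λ)).repr v i
      * φ (iota Λ (Module.Free.chooseBasis ℤ Λ i)) := by
  conv_lhs => rw [← (Algebra.TensorProduct.basis ℝ (Module.Free.chooseBasis ℤ Λ)).sum_repr v]
  rw [map_sum]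
  refine Finset.sum_congr rfl fun i _ => ?_
  rw [map_smul, smul_eq_mul, Algebra.TensorProduct.basis_apply]
  rfl

theorem aux_dense [Module.Free ℤ Λ] [Module.Finite ℤ Λ] (φ ψ : Module.Dual ℝ (RV Λ))
    (v : RV Λ) (h1 : φ v < 0) (h2 : 0 < ψ v) :
    ∃ l : Λ, φ (iota Λ l) < 0 ∧ 0 < ψ (iota Λ l) := by
  rw [aux_vec_sum] at h1 h2
  set a := fun i => φ (iota Λ (Module.Free.chooseBasis ℤ Λ i)) with ha
  set b := fun i => ψ (iota Λ (Module.Free.chooseBasis ℤ Λ i)) with hb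
  let S : Set (Module.Free.ChooseBasisIndex ℤ Λ → ℝ) :=
    {x | ∑ i, x i * a i < 0} ∩ {x | 0 < ∑ i, x i * b i}
  have hS : IsOpen S := by
    apply IsOpen.inter
    · exact isOpen_lt (by fun_prop) (by fun_prop)
    · exact isOpen_lt (by fun_prop) (by fun_prop)
  have hd : DenseRange (Pi.map (fun (_ : Module.Free.ChooseBasisIndex ℤ Λ) (q : ℚ) => (q : ℝ))) :=
    DenseRange.piMap fun _ => Rat.isDenseEmbedding_coe_real.dense
  obtain ⟨q, hq1, hq2⟩ := hd.exists_mem_open hS ⟨_, h1, h2⟩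
  simp only [Set.mem_setOf_eq, Pi.map_apply] at hq1 hq2
  let N : ℕ := ∏ i, (q i).den
  have hN : 0 < (N : ℝ) := by
    have : 0 < N := Finset.prod_pos fun i _ => (q i).pos
    exact_mod_cast this
  have hz : ∀ i, ∃ z : ℤ, (z : ℝ) = N * (q i : ℝ) := by
    intro i
    obtain ⟨k, hk⟩ : (q i).den ∣ N := Finset.dvd_prod_of_mem _ (Finset.mem_univ i)
    refine ⟨k * (q i).num, ?_⟩
    have : ((q i).den : ℚ) * q i = (q i).num := Rat.den_mul_eq_num (q i)
    have h' : ((q i).den : ℝ) * (q i : ℝ) = (q i).num := by exact_mod_cast this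
    rw [hk]
    push_cast
    rw [← h']
    ring
  choose z hz using hz
  refine ⟨∑ i, z i • Module.Free.chooseBasis ℤ Λ i, ?_, ?_⟩
  · rw [aux_iota_sum]
    simp only [hz, mul_assoc, ← Finset.mul_sum]
    exact mul_neg_of_pos_of_neg hN hq1
  · rw [aux_iota_sum]
    simp only [hz, mul_assoc, ← Finset.mul_sum]
    exact mul_pos hN hq2

theorem aux_sep [Module.Free ℤ Λ] [Module.Finite ℤ Λ] (φ ψ : Module.Dual ℝ (RV Λ))
    (hφ : φ ≠ 0) (hψ : ψ ≠ 0) (h : ∀ l, φ (iota Λ l) < 0 → ψ (iota Λ l) ≤ 0) :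
    ∃ κ : ℝ, 0 < κ ∧ ψ = κ • φ := by
  have H : ∀ v, φ v < 0 → ψ v ≤ 0 := by
    intro v hv
    by_contra! h2
    obtain ⟨l, h3, h4⟩ := aux_dense Λ φ ψ v hv h2
    exact absurd (h l h3) (not_le.2 h4)
  obtain ⟨w, hw⟩ : ∃ w, φ w ≠ 0 := by
    by_contra! h0
    exact hφ (LinearMap.ext h0)
  let v0 := (-(φ w)⁻¹) • w
  have hv0 : φ v0 = -1 := by simp [v0, hw]
  clear_value v0
  have hker : ∀ v, φ v = 0 → ψ v = 0 := by
    intro v hv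
    by_contra hne
    have := H (v0 + ((1 - ψ v0) / ψ v) • v) (by simp [hv0, hv])
    rw [map_add, map_smul, smul_eq_mul, div_mul_cancel₀ _ hne] at this
    linarith
  have heq : ψ = (-ψ v0) • φ := by
    ext1
    ext l
    have := hker ((1 : ℝ) ⊗ₜ[ℤ] l + φ ((1 : ℝ) ⊗ₜ[ℤ] l) • v0) (by simp [hv0])
    rw [map_add, map_smul, smul_eq_mul] at this
    simp
    linarith
  refine ⟨-ψ v0, ?_, heq⟩
  have h0 : ψ v0 ≤ 0 := H v0 (by rw [hv0]; norm_num)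
  rcases h0.lt_or_eq with h1 | h1
  · linarith
  · exfalso; apply hψ; rw [heq, h1]; simp

theorem aux_neg_mem (X : PosParts Λ) (l : Λ) (h : l ∉ X.val) : -l ∈ X.val := by
  have := X.2.1
  have h2 : l ∈ X.val ∪ -X.val := by rw [this]; trivial
  exact h2.resolve_left h

theorem aux_eval_cont (v : RV Λ) : Continuous (fun φ : Module.Dual ℝ (RV Λ) => φ v) := by
  rw [continuous_iff_le_induced]
  exact iInf_le (fun v : RV Λ => TopologicalSpace.induced
    (fun φ : Module.Dual ℝ (RV Λ) => φ v) inferInstance) v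

theorem aux_cont_rng {α : Type*} [TopologicalSpace α] (f : α → Module.Dual ℝ (RV Λ))
    (h : ∀ v, Continuous fun x => f x v) : Continuous f := by
  refine continuous_iInf_rng.2 fun v => continuous_induced_rng.2 (h v)

theorem aux_neg_exists [Module.Free ℤ Λ] [Module.Finite ℤ Λ] (φ : Module.Dual ℝ (RV Λ))
    (hφ : φ ≠ 0) : ∃ l, φ (iota Λ l) < 0 := by
  by_contra! h
  apply hφ
  apply aux_ext
  intro l
  have h1 := h l
  have h2 := h (-l)
  rw [map_neg, map_neg] at h2
  simp only [LinearMap.zero_apply]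
  linarith

theorem aux_finite [Module.Free ℤ Λ] [Module.Finite ℤ Λ] (φ : Module.Dual ℝ (RV Λ))
    (hφ : φ ≠ 0) (W : Set (DualQuot Λ)) (hW : IsOpen W)
    (hmem : Quotient.mk (dualSetoid Λ) φ ∈ W) :
    ∃ E : Finset Λ, (∀ l ∈ E, φ (iota Λ l) < 0) ∧ ∀ ψ : Module.Dual ℝ (RV Λ), ψ ≠ 0 →
      (∀ l ∈ E, ψ (iota Λ l) ≤ 0) → Quotient.mk (dualSetoid Λ) ψ ∈ W := by
  classical
  let B := Algebra.TensorProduct.basis ℝ (Module.Free.chooseBasis ℤ Λ)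
  let T : (Module.Free.ChooseBasisIndex ℤ Λ → ℝ) →ₗ[ℝ] Module.Dual ℝ (RV Λ) :=
    (B.constr ℝ).toLinearMap
  have hTv : ∀ c v, T c v = ∑ i, B.repr v i * c i := by
    intro c v
    simp [T, Module.Basis.constr_apply_fintype]
  have hT : Continuous T := by
    apply aux_cont_rng
    intro v
    simp only [hTv]
    fun_prop
  have hq : Continuous (fun c => Quotient.mk (dualSetoid Λ) (T c)) :=
    continuous_quotient_mk'.comp hT
  let K : Set (Module.Free.ChooseBasisIndex ℤ Λ → ℝ) :=
    Metric.sphere 0 1 ∩ (fun c => Quotient.mk (dualSetoid Λ) (T c)) ⁻¹' Wᶜ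
  have hK : IsCompact K :=
    (isCompact_sphere _ _).inter_right (hW.isClosed_compl.preimage hq)
  have hTinj : ∀ c, T c = 0 → c = 0 := by
    intro c hc
    exact (B.constr ℝ).map_eq_zero_iff.1 hc
  obtain ⟨t, ht⟩ := hK.elim_finite_subcover
    (fun l : {l : Λ // φ (iota Λ l) < 0} => {c | 0 < T c (iota Λ l)})
    (fun l => isOpen_lt continuous_const ((aux_eval_cont Λ _).comp hT)) (by
      rintro c ⟨hc1, hc2⟩
      by_contra hcon
      simp only [Set.mem_iUnion, Set.mem_setOf_eq, not_exists, not_lt, Subtype.forall] at hcon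
      have hc0 : T c ≠ 0 := by
        intro h0
        rw [hTinj c h0] at hc1
        simp at hc1
      obtain ⟨κ, hκ, he⟩ := aux_sep Λ φ (T c) hφ hc0 hcon
      apply hc2
      have : Quotient.mk (dualSetoid Λ) φ = Quotient.mk (dualSetoid Λ) (T c) :=
        Quotient.sound ⟨κ, hκ, he⟩
      show Quotient.mk (dualSetoid Λ) (T c) ∈ W
      rw [← this]; exact hmem)
  refine ⟨t.image Subtype.val, ?_, ?_⟩
  · intro l hl
    obtain ⟨l', -, rfl⟩ := Finset.mem_image.1 hl
    exact l'.2
  · intro ψ hψ hle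
    let c := (B.constr ℝ).symm ψ
    have hc : T c = ψ := (B.constr ℝ).apply_symm_apply ψ
    have hc0 : c ≠ 0 := by
      intro h0
      apply hψ
      rw [← hc, h0, map_zero]
    have hn : 0 < ‖c‖ := norm_pos_iff.2 hc0
    by_contra hcon
    have hmk : Quotient.mk (dualSetoid Λ) ψ = Quotient.mk (dualSetoid Λ) (T (‖c‖⁻¹ • c)) :=
      Quotient.sound ⟨‖c‖⁻¹, inv_pos.2 hn, by rw [map_smul, hc]⟩
    have hmemK : ‖c‖⁻¹ • c ∈ K := by
      refine ⟨?_, ?_⟩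
      · simp [norm_smul, hn.ne']
      · show Quotient.mk (dualSetoid Λ) (T (‖c‖⁻¹ • c)) ∉ W
        rw [← hmk]; exact hcon
    have := ht hmemK
    simp only [Set.mem_iUnion, Set.mem_setOf_eq] at this
    obtain ⟨l, hl, hpos⟩ := this
    rw [map_smul, hc, LinearMap.smul_apply, smul_eq_mul] at hpos
    have h3 := hle l (Finset.mem_image_of_mem _ hl)
    have := mul_nonpos_of_nonneg_of_nonpos (inv_pos.2 hn).le h3
    linarith

theorem aux_zero (W : Set (DualQuot Λ)) (hW : IsOpen W)
    (hmem : Quotient.mk (dualSetoid Λ) 0 ∈ W) : ∀ x, x ∈ W := by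
  intro x
  obtain ⟨ψ, rfl⟩ := Quotient.exists_rep x
  have hc : Continuous (fun t : ℝ => Quotient.mk (dualSetoid Λ) (t • ψ)) := by
    refine continuous_quotient_mk'.comp (aux_cont_rng Λ _ fun v => ?_)
    simp only [LinearMap.smul_apply, smul_eq_mul]
    fun_prop
  have hO := hW.preimage hc
  have h0 : (0 : ℝ) ∈ (fun t : ℝ => Quotient.mk (dualSetoid Λ) (t • ψ)) ⁻¹' W := by
    simpa using hmem
  obtain ⟨ε, hε, hb⟩ := Metric.isOpen_iff.1 hO 0 h0
  have h1 : ε / 2 ∈ Metric.ball (0 : ℝ) ε := by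
    rw [Metric.mem_ball, Real.dist_eq, sub_zero, abs_of_pos (by linarith)]
    linarith
  have h2 : Quotient.mk (dualSetoid Λ) ((ε / 2) • ψ) ∈ W := hb h1
  have : Quotient.mk (dualSetoid Λ) ψ = Quotient.mk (dualSetoid Λ) ((ε / 2) • ψ) :=
    Quotient.sound ⟨ε / 2, by linarith, rfl⟩
  rw [this]; exact h2


theorem statement12 [Module.Free ℤ Λ] [Module.Finite ℤ Λ] (π : PosParts Λ → DualQuot Λ) (hπ : IsPi Λ π) :
    Continuous π ∧ Continuous (Posbar Λ) ∧ π ∘ Posbar Λ = id := by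
  refine ⟨⟨fun W hW => ?_⟩, ?_, ?_⟩
  · intro X hX
    obtain ⟨φ, h1, h2, h3⟩ := hπ X
    have hX' : π X ∈ W := hX
    rw [h1] at hX'
    by_cases hφ : φ = 0
    · subst hφ
      exact ⟨∅, by simp [UU], fun Y _ => aux_zero Λ W hW hX' _⟩
    · classical
      obtain ⟨E, hE1, hE2⟩ := aux_finite Λ φ hφ W hW hX'
      obtain ⟨l0, hl0⟩ := aux_neg_exists Λ φ hφ
      have key : ∀ l ∈ insert l0 E, φ (iota Λ l) < 0 := by
        intro l hl
        rcases Finset.mem_insert.1 hl with rfl | h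
        · exact hl0
        · exact hE1 l h
      refine ⟨insert l0 E, ?_, ?_⟩
      · apply Set.eq_empty_of_forall_notMem
        rintro l ⟨hl1, hl2⟩
        exact absurd (h2 hl1) (not_le.2 (key l hl2))
      · intro Y hY
        have hY' : ∀ l ∈ insert l0 E, l ∉ Y.val := by
          intro l hl hlY
          have : l ∈ Y.val ∩ ((insert l0 E : Finset Λ) : Set Λ) := ⟨hlY, hl⟩
          rw [show Y.val ∩ ((insert l0 E : Finset Λ) : Set Λ) = ∅ from hY] at this
          exact this
        obtain ⟨ψ, g1, g2, g3⟩ := hπ Y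
        show π Y ∈ W
        rw [g1]
        apply hE2 ψ
        · apply g3
          intro hu
          apply hY' l0 (Finset.mem_insert_self _ _)
          rw [hu]; trivial
        · intro l hl
          have h4 : 0 ≤ ψ (iota Λ (-l)) :=
            g2 (aux_neg_mem Λ Y l (hY' l (Finset.mem_insert_of_mem hl)))
          rw [map_neg, map_neg] at h4
          linarith
  · refine continuous_quot_lift _ ⟨fun U hU => ?_⟩
    rw [isOpen_iff_mem_nhds]
    intro φ hφ
    obtain ⟨E, hE1, hE2⟩ := hU _ hφ
    have hO : IsOpen (⋂ l ∈ E, {ψ : Module.Dual ℝ (RV Λ) | ψ (iota Λ l) < 0}) :=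
      isOpen_biInter_finset fun l _ => isOpen_lt (aux_eval_cont Λ _) continuous_const
    refine Filter.mem_of_superset (hO.mem_nhds ?_) ?_
    · simp only [Set.mem_iInter, Set.mem_setOf_eq]
      intro l hl
      by_contra! hcon
      have : l ∈ PosSet Λ φ ∩ (E : Set Λ) := ⟨hcon, hl⟩
      rw [show PosSet Λ φ ∩ (E : Set Λ) = ∅ from hE1] at this
      exact this
    · intro ψ hψ
      simp only [Set.mem_iInter, Set.mem_setOf_eq] at hψ
      apply hE2
      apply Set.eq_empty_of_forall_notMem
      rintro l ⟨hl1, hl2⟩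
      exact absurd hl1 (not_le.2 (hψ l hl2))
  · funext x
    obtain ⟨φ, rfl⟩ := Quotient.exists_rep x
    obtain ⟨ψ, h1, h2, h3⟩ := hπ (Posbar Λ (Quotient.mk (dualSetoid Λ) φ))
    change PosSet Λ φ ⊆ PosSet Λ ψ at h2
    change PosSet Λ φ ≠ Set.univ → ψ ≠ 0 at h3
    simp only [Function.comp_apply, id]
    rw [h1]
    by_cases hφ : φ = 0
    · subst hφ
      have : ψ = 0 := by
        by_contra hne
        obtain ⟨l, hl⟩ := aux_neg_exists Λ ψ hne
        exact absurd (h2 (show (0:ℝ) ≤ _ by simp)) (not_le.2 hl)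
      rw [this]
    · obtain ⟨l, hl⟩ := aux_neg_exists Λ φ hφ
      have hψ : ψ ≠ 0 := h3 (by
        intro hu
        have : l ∈ PosSet Λ φ := by rw [hu]; trivial
        exact absurd this (not_le.2 hl))
      refine (Quotient.sound (aux_sep Λ φ ψ hφ hψ ?_)).symm
      intro m hm
      have h4 : (0:ℝ) ≤ ψ (iota Λ (-m)) := h2 (by
        show (0:ℝ) ≤ φ (iota Λ (-m))
        rw [map_neg, map_neg]; linarith)
      rw [map_neg, map_neg] at h4
      linarith
end

section
/- Let φ be a nonzero linear form on V. Then the intersection of all open subsets of Pos(Λ) containing the point Pos(φ) equals the image of i_φ̄, which in turn equals the fiber π^{-1}(φ̄). -/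
open scoped TensorProduct

variable (Λ : Type) [AddCommGroup Λ]

/-- `Pos⁺(φ) = {λ ∈ Λ | φ(λ) > 0}` for a linear form `φ` on `V = ℝ ⊗_ℤ Λ`. -/
def PosPlus (φ : Module.Dual ℝ (RV Λ)) : Set Λ := {l | 0 < φ (iota Λ l)}

/-- The lattice `Ker φ|_Λ = Λ ∩ Ker φ`. -/
noncomputable def kerLat (φ : Module.Dual ℝ (RV Λ)) : AddSubgroup Λ :=
  AddMonoidHom.ker ((φ.toAddMonoidHom).comp (iota Λ).toAddMonoidHom)

/-- The underlying subset of `Λ` of `i_φ̄(X) = X ∪ Pos⁺(φ)`, for `X ⊆ Ker φ|_Λ`. -/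
noncomputable def iSet (φ : Module.Dual ℝ (RV Λ)) (S : Set (kerLat Λ φ)) : Set Λ :=
  (Subtype.val '' S) ∪ PosPlus Λ φ

theorem aux_dual_ext (φ ψ : Module.Dual ℝ (RV Λ)) (h : ∀ l, φ (iota Λ l) = ψ (iota Λ l)) :
    φ = ψ := by
  refine LinearMap.ext fun x => ?_
  induction x using TensorProduct.induction_on with
  | zero => simp
  | tmul r l =>
    have e : r ⊗ₜ[ℤ] l = r • (iota Λ l) := by
      change r ⊗ₜ[ℤ] l = r • ((1 : ℝ) ⊗ₜ[ℤ] l)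
      rw [TensorProduct.smul_tmul', smul_eq_mul, mul_one]
    rw [e, map_smul, map_smul, h]
  | add x y hx hy => rw [map_add, map_add, hx, hy]

theorem aux_half (a b a' b' : ℝ) (ha : 0 < a) (ha' : 0 ≤ a')
    (h : ∀ n m : ℤ, 0 < n * b + m * a → 0 ≤ n * b' + m * a') : b' * a ≤ a' * b := by
  by_contra! hc
  obtain ⟨N, hN⟩ := exists_nat_gt (a' * a / (b' * a - a' * b))
  have hd : 0 < b' * a - a' * b := by linarith
  rw [div_lt_iff₀ hd] at hN
  have h1 := Int.lt_floor_add_one ((N : ℝ) * b / a)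
  have h2 := Int.floor_le ((N : ℝ) * b / a)
  rw [div_lt_iff₀ ha] at h1
  rw [le_div_iff₀ ha] at h2
  have h3 := h (-(N : ℤ)) (⌊(N : ℝ) * b / a⌋ + 1) (by push_cast; linarith)
  push_cast at h3
  have h4 := mul_nonneg h3 ha.le
  have h5 := mul_le_mul_of_nonneg_right h2 ha'
  nlinarith

theorem aux_posPlus_sub {Y : Set Λ} (hY : IsPositivePart Λ Y) (φ : Module.Dual ℝ (RV Λ))
    (h : Y ⊆ PosSet Λ φ) : PosPlus Λ φ ⊆ Y := by
  intro l hl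
  have hl' : 0 < φ (iota Λ l) := hl
  have : l ∈ Y ∪ -Y := by rw [hY.1]; trivial
  rcases this with h1 | h1
  · exact h1
  · have h2 : 0 ≤ φ (iota Λ (-l)) := h h1
    rw [map_neg, map_neg] at h2
    linarith

theorem aux_prop (φ ψ : Module.Dual ℝ (RV Λ)) (hφ : φ ≠ 0) (hψ : ψ ≠ 0)
    (h : PosPlus Λ φ ⊆ PosSet Λ ψ) : ∃ κ : ℝ, 0 < κ ∧ ψ = κ • φ := by
  obtain ⟨a, ha⟩ : ∃ a, 0 < φ (iota Λ a) := by
    by_contra! hc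
    apply hφ
    apply aux_dual_ext
    intro l
    have h1 := hc l
    have h2 := hc (-l)
    rw [map_neg, map_neg] at h2
    simp only [LinearMap.zero_apply]
    linarith
  have ha' : 0 ≤ ψ (iota Λ a) := h ha
  have key : ∀ b, ψ (iota Λ b) * φ (iota Λ a) ≤ ψ (iota Λ a) * φ (iota Λ b) := by
    intro b
    apply aux_half _ _ _ _ ha ha'
    intro n m hnm
    have e : ∀ χ : Module.Dual ℝ (RV Λ), χ (iota Λ (n • b + m • a))
        = n * χ (iota Λ b) + m * χ (iota Λ a) := by
      intro χ
      rw [map_add, map_add, map_zsmul, map_zsmul, map_zsmul, map_zsmul, zsmul_eq_mul, zsmul_eq_mul]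
    have h1 : 0 ≤ ψ (iota Λ (n • b + m • a)) := h (show 0 < φ _ by rw [e]; exact hnm)
    rwa [e] at h1
  have hE : ψ = (ψ (iota Λ a) / φ (iota Λ a)) • φ := by
    apply aux_dual_ext
    intro b
    have h1 := key b
    have h2 := key (-b)
    simp only [map_neg] at h2
    rw [LinearMap.smul_apply, smul_eq_mul, div_mul_eq_mul_div, eq_div_iff ha.ne']
    linarith
  refine ⟨_, ?_, hE⟩
  rcases (div_nonneg ha' ha.le).lt_or_eq with h0 | h0
  · exact h0
  · rw [← h0, zero_smul] at hE
    exact absurd hE hψ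

theorem aux_mem_ker (φ : Module.Dual ℝ (RV Λ)) (l : Λ) :
    l ∈ kerLat Λ φ ↔ φ (iota Λ l) = 0 := Iff.rfl

theorem aux_image (φ : Module.Dual ℝ (RV Λ)) (Y : PosParts Λ) :
    (∃ X : PosParts ↥(kerLat Λ φ), Y.val = iSet Λ φ X.val) ↔ Y.val ⊆ PosSet Λ φ := by
  constructor
  · rintro ⟨X, hX⟩ l hl
    rw [hX] at hl
    rcases hl with ⟨k, _, rfl⟩ | hl
    · exact ((aux_mem_ker Λ φ _).1 k.2).ge
    · exact le_of_lt (show 0 < φ (iota Λ l) from hl)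
  · intro h
    obtain ⟨h1, h2, H, hH⟩ := Y.2
    refine ⟨⟨{k | (k : Λ) ∈ Y.val}, ?_, ?_, H.comap (kerLat Λ φ).subtype, ?_⟩, ?_⟩
    · ext k
      have : (k : Λ) ∈ Y.val ∪ -Y.val := by rw [h1]; trivial
      simpa using this
    · intro a ha b hb
      exact h2 _ ha _ hb
    · ext k
      have : (k : Λ) ∈ (H : Set Λ) ↔ (k : Λ) ∈ Y.val ∩ -Y.val := by rw [hH]
      exact this
    · ext l
      constructor
      · intro hl
        have h0 : 0 ≤ φ (iota Λ l) := h hl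
        rcases h0.lt_or_eq with h0 | h0
        · exact Or.inr h0
        · exact Or.inl ⟨⟨l, (aux_mem_ker Λ φ l).2 h0.symm⟩, hl, rfl⟩
      · rintro (⟨k, hk, rfl⟩ | hl)
        · exact hk
        · exact aux_posPlus_sub Λ Y.2 φ h hl

theorem statement16 [Module.Free ℤ Λ] [Module.Finite ℤ Λ] (φ : Module.Dual ℝ (RV Λ)) (hφ : φ ≠ 0)
    (π : PosParts Λ → DualQuot Λ) (hπ : IsPi Λ π) :
    ⋂₀ {U : Set (PosParts Λ) | IsOpen U ∧
        (⟨PosSet Λ φ, isPositivePart_posSet Λ φ⟩ : PosParts Λ) ∈ U}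
      = {Y : PosParts Λ | ∃ X : PosParts ↥(kerLat Λ φ), Y.val = iSet Λ φ X.val} ∧
    {Y : PosParts Λ | ∃ X : PosParts ↥(kerLat Λ φ), Y.val = iSet Λ φ X.val}
      = π ⁻¹' {Quotient.mk (dualSetoid Λ) φ} := by
  constructor
  · ext Y
    rw [Set.mem_setOf_eq, aux_image]
    constructor
    · intro h l hl
      by_contra hn
      have hU : IsOpen (UU Λ ({l} : Set Λ)) := by
        intro X hX
        exact ⟨{l}, by simpa using hX, by simp⟩
      have h1 : Y ∈ UU Λ ({l} : Set Λ) := by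
        refine h _ ⟨hU, ?_⟩
        change PosSet Λ φ ∩ {l} = ∅
        simpa using hn
      have h2 : Y.val ∩ {l} = ∅ := h1
      have h3 : l ∈ Y.val ∩ {l} := ⟨hl, rfl⟩
      rw [h2] at h3
      exact h3
    · rintro h U ⟨hU, hm⟩
      obtain ⟨E, hE, hE'⟩ := hU _ hm
      apply hE'
      have hE2 : PosSet Λ φ ∩ E = ∅ := hE
      exact Set.subset_eq_empty (Set.inter_subset_inter_left _ h) hE2
  · ext Y
    rw [Set.mem_setOf_eq, aux_image, Set.mem_preimage, Set.mem_singleton_iff]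
    obtain ⟨ψ, h1, h2, h3⟩ := hπ Y
    rw [h1]
    constructor
    · intro h
      have hne : Y.val ≠ Set.univ := by
        intro hu
        apply hφ
        apply aux_dual_ext
        intro l
        have e1 : 0 ≤ φ (iota Λ l) := h (by rw [hu]; trivial)
        have e2 : 0 ≤ φ (iota Λ (-l)) := h (by rw [hu]; trivial)
        rw [map_neg, map_neg] at e2
        simp only [LinearMap.zero_apply]
        linarith
      obtain ⟨κ, hκ, e⟩ := aux_prop Λ φ ψ hφ (h3 hne) ((aux_posPlus_sub Λ Y.2 φ h).trans h2)
      exact (Quotient.sound (s := dualSetoid Λ) ⟨κ, hκ, e⟩).symm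
    · intro h
      obtain ⟨κ, hκ, e⟩ := Quotient.exact (s := dualSetoid Λ) h
      intro l hl
      have := h2 hl
      show 0 ≤ φ _
      rw [e]
      exact mul_nonneg hκ.le this
end

section
/- Let λ ∈ Λ \ {0}. Then the rational hyperplane H_λ is closed in Pos(Λ), the sets U(λ) and U(−λ) are the connected components of Pos(Λ) \ H_λ, and the closure of U(λ) in Pos(Λ) equals U(λ) ∪ H_λ. -/
open scoped TensorProduct

variable (Λ : Type) [AddCommGroup Λ]

/-- `L(E) = {X ∈ Pos(Λ) | E ⊆ X ∩ (-X)}`, a rational subspace of `Pos(Λ)`. -/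
def LL (E : Set Λ) : Set (PosParts Λ) := {X | E ⊆ X.val ∩ (-X.val)}

/-- The rational hyperplane `H_λ = L({λ})`. -/
def HH (l : Λ) : Set (PosParts Λ) := LL Λ {l}

theorem aux_gordan [Module.Free ℤ Λ] (S : Set Λ)
    (hS : ∀ a ∈ S, ∀ b ∈ S, a + b ∈ S) (h0 : (0 : Λ) ∉ S) (n : ℕ) :
    ∀ F : Finset Λ, F.card ≤ n → (∀ x ∈ F, x ∈ S) →
      ∃ f : Λ →ₗ[ℤ] ℤ, ∀ x ∈ F, 0 < f x := by
  classical
  have hmul : ∀ k : ℕ, ∀ a ∈ S, ((k : ℤ) + 1) • a ∈ S := by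
    intro k a ha
    induction k with
    | zero => simpa using ha
    | succ k ih =>
      have := hS _ ih _ ha
      rw [add_smul ((k + 1 : ℕ) : ℤ), one_smul]
      push_cast
      exact this
  have hmul' : ∀ k : ℤ, 0 < k → ∀ a ∈ S, k • a ∈ S := by
    intro k hk a ha
    have := hmul (k - 1).toNat a ha
    rwa [show (((k - 1).toNat : ℕ) : ℤ) + 1 = k by omega] at this
  have pert : ∀ (F : Finset Λ) (f g : Λ →ₗ[ℤ] ℤ), (∀ x ∈ F, 0 < f x) →
      ∃ N : ℤ, 0 < N ∧ ∀ x ∈ F, 0 < N * f x + g x := by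
    intro F f g hf
    have h0 : 0 ≤ ∑ x ∈ F, |g x| := Finset.sum_nonneg fun _ _ => abs_nonneg _
    refine ⟨1 + ∑ x ∈ F, |g x|, by omega, ?_⟩
    intro x hx
    have h1 : |g x| ≤ ∑ x ∈ F, |g x| :=
      Finset.single_le_sum (f := fun x => |g x|) (fun _ _ => abs_nonneg _) hx
    have h2 := hf x hx
    have h3 := neg_abs_le (g x)
    nlinarith
  induction n with
  | zero =>
    intro F hF _
    have hF : F = ∅ := by simpa using hF
    subst hF
    exact ⟨0, by simp⟩
  | succ n ih =>
    intro F hF hFS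
    rcases F.eq_empty_or_nonempty with rfl | ⟨v, hvF⟩
    · exact ⟨0, by simp⟩
    have hvS : v ∈ S := hFS v hvF
    have hF'S : ∀ x ∈ F.erase v, x ∈ S := fun x hx => hFS x (Finset.mem_of_mem_erase hx)
    have hc : (F.erase v).card ≤ n := by
      rw [Finset.card_erase_of_mem hvF]; omega
    have fin : ∀ f : Λ →ₗ[ℤ] ℤ, 0 < f v → (∀ x ∈ F.erase v, 0 < f x) → 
        ∃ f : Λ →ₗ[ℤ] ℤ, ∀ x ∈ F, 0 < f x := by
      intro f h1 h2
      refine ⟨f, fun x hx => ?_⟩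
      by_cases hxv : x = v
      · rwa [hxv]
      · exact h2 x (Finset.mem_erase.2 ⟨hxv, hx⟩)
    obtain ⟨f, hf⟩ := ih (F.erase v) hc hF'S
    rcases lt_trichotomy (f v) 0 with h | h | h
    · have key : ∃ g : Λ →ₗ[ℤ] ℤ, ∀ w ∈ F.erase v, 0 < g ((-f v) • w + f w • v) := by
        obtain ⟨g, hg⟩ := ih ((F.erase v).image fun w => (-f v) • w + f w • v)
          (Finset.card_image_le.trans hc) (by
            intro x hx
            obtain ⟨w, hw, rfl⟩ := Finset.mem_image.1 hx
            exact hS _ (hmul' _ (by omega) _ (hF'S w hw)) _ (hmul' _ (hf w hw) _ hvS))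
        exact ⟨g, fun w hw => hg _ (Finset.mem_image_of_mem _ hw)⟩
      obtain ⟨g, hg⟩ := key
      obtain ⟨N, hN, hN'⟩ := pert (F.erase v) ((-f v) • g + g v • f) (-f) (by
        intro x hx
        have := hg x hx
        simp only [map_add, map_smul, smul_eq_mul, LinearMap.add_apply,
          LinearMap.smul_apply] at this ⊢
        linarith)
      refine fin (N • ((-f v) • g + g v • f) + -f) ?_ ?_
      · simp only [LinearMap.add_apply, LinearMap.smul_apply, smul_eq_mul, LinearMap.neg_apply]
        nlinarith
      · intro x hx
        exact hN' x hx
    · have hv0 : v ≠ 0 := fun h => h0 (h ▸ hvS)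
      obtain ⟨g, hg⟩ : ∃ g : Λ →ₗ[ℤ] ℤ, 0 < g v := by
        obtain ⟨g, hg⟩ : ∃ g : Λ →ₗ[ℤ] ℤ, g v ≠ 0 := by
          by_contra! hcon
          exact hv0 ((Module.forall_dual_apply_eq_zero_iff ℤ v).1 hcon)
        rcases lt_or_gt_of_ne hg with h | h
        · exact ⟨-g, by simpa using h⟩
        · exact ⟨g, h⟩
      obtain ⟨N, hN, hN'⟩ := pert (F.erase v) f g hf
      refine fin (N • f + g) ?_ ?_
      · simpa [h] using hg
      · intro x hx
        simpa using hN' x hx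
    · exact fin f h hf

/-- The half space of a functional. -/
def auxHalf (f : Λ →ₗ[ℤ] ℝ) : PosParts Λ :=
  ⟨{x | f x ≤ 0}, by
    refine ⟨?_, ?_, ⟨f.toAddMonoidHom.ker, ?_⟩⟩
    · ext x
      simpa using le_total (f x) 0
    · intro a ha b hb
      simp only [Set.mem_setOf_eq, map_add] at *
      linarith
    · ext x
      simp [AddMonoidHom.mem_ker, le_antisymm_iff]⟩

theorem aux_mem_half (f : Λ →ₗ[ℤ] ℝ) (E : Set Λ) :
    auxHalf Λ f ∈ UU Λ E ↔ ∀ e ∈ E, 0 < f e := by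
  constructor
  · intro h e he
    by_contra hc
    have h' : e ∈ {x | f x ≤ 0} ∩ E := ⟨not_lt.1 hc, he⟩
    rw [show {x | f x ≤ 0} ∩ E = ∅ from h] at h'
    exact h'
  · intro h
    exact Set.eq_empty_iff_forall_notMem.2 fun e he => absurd (h e he.2) (not_lt.2 he.1)

theorem aux_exists [Module.Free ℤ Λ] (S : Set Λ)
    (hS : ∀ a ∈ S, ∀ b ∈ S, a + b ∈ S) (h0 : (0 : Λ) ∉ S) (F : Finset Λ)
    (hF : ∀ x ∈ F, x ∈ S) : ∃ f : Λ →ₗ[ℤ] ℝ, ∀ x ∈ F, 0 < f x := by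
  obtain ⟨f, hf⟩ := aux_gordan Λ S hS h0 _ F le_rfl hF
  refine ⟨(Int.castAddHom ℝ).toIntLinearMap ∘ₗ f, fun x hx => ?_⟩
  simpa using hf x hx

theorem aux_open (E : Finset Λ) : IsOpen (UU Λ (E : Set Λ)) :=
  fun _ hX => ⟨E, hX, subset_rfl⟩

theorem aux_open1 (l : Λ) : IsOpen (UU Λ {l}) := by
  simpa using aux_open Λ {l}

theorem aux_mem1 (l : Λ) (X : PosParts Λ) : X ∈ UU Λ {l} ↔ l ∉ X.val := by
  simp [UU]

theorem aux_memH (l : Λ) (X : PosParts Λ) : X ∈ HH Λ l ↔ l ∈ X.val ∧ -l ∈ X.val := by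
  simp [HH, LL]

theorem aux_tot (X : PosParts Λ) (a : Λ) : a ∈ X.val ∨ -a ∈ X.val := by
  have : a ∈ X.val ∪ (-X.val) := by rw [X.2.1]; trivial
  simpa using this

theorem aux_compl (l : Λ) : (HH Λ l)ᶜ = UU Λ {l} ∪ UU Λ {-l} := by
  ext X
  rw [Set.mem_compl_iff, Set.mem_union, aux_mem1, aux_mem1, aux_memH]
  tauto

theorem aux_zero_s19 (X : PosParts Λ) : (0 : Λ) ∈ X.val := by
  simpa using aux_tot Λ X 0

theorem aux_neg_add (X : PosParts Λ) (a b : Λ) (ha : a ∉ X.val) (hb : -b ∈ X.val) :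
    a + b ∉ X.val := by
  intro h
  apply ha
  simpa using X.2.2.1 _ h _ hb

theorem aux_preconn [Module.Free ℤ Λ] (l : Λ) : IsPreconnected (UU Λ {l}) := by
  classical
  have hD : IsPreconnected {X | ∃ f : Λ →ₗ[ℤ] ℝ, 0 < f l ∧ X = auxHalf Λ f} := by
    apply isPreconnected_of_forall_pair
    rintro _ ⟨f, hf, rfl⟩ _ ⟨g, hg, rfl⟩
    have hcont : Continuous fun t : ℝ => auxHalf Λ ((1 - t) • f + t • g) := by
      rw [continuous_def]
      intro U hU
      rw [isOpen_iff_mem_nhds]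
      intro t ht
      obtain ⟨E, hE, hEU⟩ := hU _ ht
      rw [aux_mem_half] at hE
      have : ∀ᶠ s in nhds t, ∀ e ∈ E, 0 < ((1 - s) • f + s • g) e := by
        rw [Filter.eventually_all_finset]
        intro e he
        have hc : Continuous fun s : ℝ => ((1 - s) • f + s • g) e := by
          simp only [LinearMap.add_apply, LinearMap.smul_apply, smul_eq_mul]
          fun_prop
        exact hc.continuousAt.eventually (lt_mem_nhds (hE e he))
      filter_upwards [this] with s hs
      exact hEU ((aux_mem_half Λ _ _).2 hs)
    refine ⟨(fun t : ℝ => auxHalf Λ ((1 - t) • f + t • g)) '' Set.Icc 0 1, ?_, ⟨0, by simp, by simp⟩,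
      ⟨1, by simp, by simp⟩, isPreconnected_Icc.image _ hcont.continuousOn⟩
    rintro _ ⟨t, ⟨h0, h1⟩, rfl⟩
    refine ⟨_, ?_, rfl⟩
    simp only [LinearMap.add_apply, LinearMap.smul_apply, smul_eq_mul]
    rcases h0.eq_or_lt with rfl | h0
    · simpa using hf
    · have := mul_pos h0 hg
      have := mul_nonneg (sub_nonneg.2 h1) hf.le
      linarith
  refine hD.subset_closure ?_ ?_
  · rintro _ ⟨f, hf, rfl⟩
    rw [aux_mem_half]
    simpa using hf
  · intro X hX
    rw [mem_closure_iff]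
    intro U hU hXU
    obtain ⟨E, hE, hEU⟩ := hU X hXU
    obtain ⟨f, hf⟩ := aux_exists Λ (X.val)ᶜ
      (fun a ha b hb => aux_neg_add Λ X a b ha ((aux_tot Λ X b).resolve_left hb))
      (fun h => h (aux_zero_s19 Λ X)) (insert l E) (by
        intro x hx
        rw [Finset.mem_insert] at hx
        rcases hx with rfl | hx
        · exact (aux_mem1 Λ _ X).1 hX
        · intro hxX
          have : x ∈ X.val ∩ E := ⟨hxX, hx⟩
          rw [show X.val ∩ E = ∅ from hE] at this
          exact this)
    exact ⟨auxHalf Λ f, hEU ((aux_mem_half Λ _ _).2 fun e he => hf e (by simp at he; simp [he])),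
      f, hf l (by simp), rfl⟩

theorem aux_cl [Module.Free ℤ Λ] (l : Λ) (hl : l ≠ 0) : HH Λ l ⊆ closure (UU Λ {l}) := by
  classical
  intro X hX
  rw [aux_memH] at hX
  have hn : ∀ n : ℕ, -((n + 1) • l) ∈ X.val := by
    intro n
    induction n with
    | zero => simpa using hX.2
    | succ n ih =>
      rw [succ_nsmul, neg_add]
      exact X.2.2.1 _ ih _ hX.2
  rw [mem_closure_iff]
  intro U hU hXU
  obtain ⟨E, hE, hEU⟩ := hU X hXU
  obtain ⟨f, hf⟩ := aux_exists Λ ((X.val)ᶜ ∪ {x | ∃ n : ℕ, x = (n + 1) • l})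
    (by
      rintro a (ha | ⟨n, rfl⟩) b (hb | ⟨m, rfl⟩)
      · exact Or.inl (aux_neg_add Λ X a b ha ((aux_tot Λ X b).resolve_left hb))
      · exact Or.inl (aux_neg_add Λ X a _ ha (hn m))
      · rw [add_comm]
        exact Or.inl (aux_neg_add Λ X b _ hb (hn n))
      · refine Or.inr ⟨n + m + 1, ?_⟩
        rw [← add_nsmul]
        congr 1
        omega)
    (by
      rintro (h | ⟨n, h⟩)
      · exact h (aux_zero_s19 Λ X)
      · have h' : ((n + 1 : ℕ) : ℤ) • l = 0 := by rw [natCast_zsmul]; exact h.symm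
        rcases smul_eq_zero.1 h' with h | h
        · omega
        · exact hl h) (insert l E) (by
      intro x hx
      rw [Finset.mem_insert] at hx
      rcases hx with rfl | hx
      · exact Or.inr ⟨0, by simp⟩
      · left
        intro hxX
        have : x ∈ X.val ∩ E := ⟨hxX, hx⟩
        rw [show X.val ∩ E = ∅ from hE] at this
        exact this)
  exact ⟨auxHalf Λ f, hEU ((aux_mem_half Λ _ _).2 fun e he => hf e (by simp at he; simp [he])),
    (aux_mem_half Λ _ _).2 (by simpa using hf l (by simp))⟩

theorem aux_disj (l : Λ) : Disjoint (UU Λ {l}) (UU Λ {-l}) := by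
  rw [Set.disjoint_left]
  intro X h1 h2
  rw [aux_mem1] at h1 h2
  exact (aux_tot Λ X l).elim h1 h2

theorem aux_nonempty [Module.Free ℤ Λ] (l : Λ) (hl : l ≠ 0) : (UU Λ {l}).Nonempty := by
  have : (⟨Set.univ, by simp, by simp, ⊤, by simp⟩ : PosParts Λ) ∈ HH Λ l := by
    exact (aux_memH Λ l _).2 ⟨trivial, trivial⟩
  exact closure_nonempty_iff.1 ⟨_, aux_cl Λ l hl this⟩

theorem aux_comp [Module.Free ℤ Λ] (l : Λ) (X : PosParts Λ) (hX : X ∈ UU Λ {l}) :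
    connectedComponentIn ((HH Λ l)ᶜ) X = UU Λ {l} := by
  have hXc : X ∈ (HH Λ l)ᶜ := by rw [aux_compl]; exact Or.inl hX
  apply subset_antisymm
  · refine IsPreconnected.subset_left_of_subset_union (aux_open1 Λ l) (aux_open1 Λ (-l))
      (aux_disj Λ l) ?_ ⟨X, mem_connectedComponentIn hXc, hX⟩ isPreconnected_connectedComponentIn
    rw [← aux_compl]
    exact connectedComponentIn_subset _ _
  · refine (aux_preconn Λ l).subset_connectedComponentIn hX ?_
    rw [aux_compl]
    exact Set.subset_union_left

theorem statement19 [Module.Free ℤ Λ] [Module.Finite ℤ Λ] (l : Λ) (hl : l ≠ 0) :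
    IsClosed (HH Λ l) ∧
    ((fun X : PosParts Λ => connectedComponentIn ((HH Λ l)ᶜ) X) '' (HH Λ l)ᶜ
      = {UU Λ {l}, UU Λ {-l}}) ∧
    closure (UU Λ {l}) = UU Λ {l} ∪ HH Λ l := by
  have hneg : HH Λ (-l) = HH Λ l := by
    ext X
    rw [aux_memH, aux_memH, neg_neg, and_comm]
  have hcomp2 : ∀ X ∈ UU Λ {-l}, connectedComponentIn ((HH Λ l)ᶜ) X = UU Λ {-l} := by
    intro X hX
    rw [← hneg]
    exact aux_comp Λ (-l) X hX
  refine ⟨?_, ?_, ?_⟩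
  · rw [← isOpen_compl_iff, aux_compl]
    exact (aux_open1 Λ l).union (aux_open1 Λ (-l))
  · apply subset_antisymm
    · rintro _ ⟨X, hX, rfl⟩
      rw [aux_compl] at hX
      rcases hX with hX | hX
      · exact Or.inl (aux_comp Λ l X hX)
      · exact Or.inr (hcomp2 X hX)
    · rintro _ (rfl | rfl)
      · obtain ⟨X, hX⟩ := aux_nonempty Λ l hl
        exact ⟨X, by rw [aux_compl]; exact Or.inl hX, aux_comp Λ l X hX⟩
      · obtain ⟨X, hX⟩ := aux_nonempty Λ (-l) (neg_ne_zero.2 hl)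
        exact ⟨X, by rw [aux_compl]; exact Or.inr hX, hcomp2 X hX⟩
  · apply subset_antisymm
    · have : UU Λ {l} ∪ HH Λ l = (UU Λ {-l})ᶜ := by
        ext X
        rw [Set.mem_compl_iff, Set.mem_union, aux_mem1, aux_mem1, aux_memH]
        have := aux_tot Λ X l
        tauto
      rw [this]
      refine closure_minimal ?_ (aux_open1 Λ (-l)).isClosed_compl
      exact (aux_disj Λ l).subset_compl_right
    · exact Set.union_subset subset_closure (aux_cl Λ l hl)
end
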